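/- arXiv:1609.08839 — 3 statements merged into one kernel-verified Lean document; each statement's English description precedes it below -/
import Mathlib

section
/- Let f be a continuous real-valued function on [-1,1], let n ≥ 2, and let p_n be the unique polynomial of degree at most n that interpolates f at the n+1 Chebyshev nodes x_k = cos((2k+1)π/(2n+2)), k = 0, …, n. Then the interpolation error E_n^{interp}(f) = sup_{x ∈ [-1,1]} |f(x) - p_n(x)| satisfies E_n^{interp}(f) ≤ (9 + (4/π)·log n) · E_n(f), where E_n(f) = inf { sup_{x ∈ [-1,1]} |f(x) - q(x)| : q a real polynomial of degree at most n } is the error of best uniform polynomial approximation of degree n. -/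
open Real Set Polynomial

/-- `t cos t ≤ sin t` on `[0, π]`. -/
lemma aux_mul_cos_le_sin {t : ℝ} (h0 : 0 ≤ t) (h1 : t ≤ π) : t * cos t ≤ sin t := by
  by_cases h : t < π / 2
  · have hc : 0 < cos t := cos_pos_of_mem_Ioo ⟨by linarith [pi_pos], h⟩
    have := le_tan h0 h
    rwa [tan_eq_sin_div_cos, le_div_iff₀ hc] at this
  · have hc : cos t ≤ 0 := cos_nonpos_of_pi_div_two_le_of_le (by linarith) (by linarith)
    have := sin_nonneg_of_nonneg_of_le_pi h0 h1
    nlinarith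

/-- The basic trigonometric inequality. -/
lemma aux_trig {a b : ℝ} (ha0 : 0 ≤ a) (ha1 : a ≤ π) (hb0 : 0 ≤ b) (hb1 : b ≤ π) :
    sin b * |a - b| ≤ 2 * |cos a - cos b| := by
  obtain ⟨u, hu⟩ : ∃ u, u = (a + b) / 2 := ⟨_, rfl⟩
  obtain ⟨v, hv⟩ : ∃ v, v = (a - b) / 2 := ⟨_, rfl⟩
  have hb : b = u - v := by rw [hu, hv]; ring
  have hcc : |cos a - cos b| = 2 * (sin u * sin |v|) := by
    rw [cos_sub_cos, ← hu, ← hv, abs_mul, abs_mul,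
      abs_of_nonneg (sin_nonneg_of_nonneg_of_le_pi (by linarith : 0 ≤ u) (by linarith))]
    have : |sin v| = sin |v| := by
      rcases abs_cases v with ⟨h, h'⟩ | ⟨h, h'⟩
      · rw [h, abs_of_nonneg (sin_nonneg_of_nonneg_of_le_pi h' (by linarith))]
      · rw [h, ← abs_neg, ← sin_neg,
          abs_of_nonneg (sin_nonneg_of_nonneg_of_le_pi (by linarith) (by linarith))]
    rw [this]; norm_num; ring
  have hab : |a - b| = 2 * |v| := by rw [hv, abs_div]; norm_num; ring
  have hs : sin b ≤ sin u * cos |v| + |cos u| * sin |v| := by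
    rw [hb, sin_sub, cos_abs]
    rcases abs_cases v with ⟨h, h'⟩ | ⟨h, h'⟩
    · rw [h]
      have : 0 ≤ sin v := sin_nonneg_of_nonneg_of_le_pi h' (by linarith)
      nlinarith [neg_abs_le (cos u)]
    · rw [h, sin_neg]
      have : 0 ≤ sin (-v) := sin_nonneg_of_nonneg_of_le_pi (by linarith) (by linarith)
      rw [sin_neg] at this
      nlinarith [le_abs_self (cos u)]
  have hv0 : 0 ≤ |v| := abs_nonneg v
  have hvu : |v| ≤ u := abs_le.2 ⟨by linarith, by linarith⟩
  have hvu' : |v| ≤ π - u := abs_le.2 ⟨by linarith, by linarith⟩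
  have h1 : |v| * cos |v| ≤ sin |v| := aux_mul_cos_le_sin hv0 (by linarith)
  have hsu : 0 ≤ sin u := sin_nonneg_of_nonneg_of_le_pi (by linarith) (by linarith)
  have hsv : 0 ≤ sin |v| := sin_nonneg_of_nonneg_of_le_pi (by linarith) (by linarith)
  have h2 : |v| * |cos u| ≤ sin u := by
    rcases abs_cases (cos u) with ⟨h, h'⟩ | ⟨h, h'⟩
    · rw [h]
      have := aux_mul_cos_le_sin (by linarith : 0 ≤ u) (by linarith)
      nlinarith
    · rw [h]
      have := aux_mul_cos_le_sin (by linarith : 0 ≤ π - u) (by linarith)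
      rw [cos_pi_sub, sin_pi_sub] at this
      nlinarith
  rw [hcc, hab]
  have e1 := mul_le_mul_of_nonneg_left h1 hsu
  have e2 := mul_le_mul_of_nonneg_right h2 hsv
  have e3 := mul_le_mul_of_nonneg_right hs hv0
  nlinarith

/-- The angle of the `k`-th Chebyshev node. -/
noncomputable def auxAng (n k : ℕ) : ℝ := (2 * k + 1) * π / (2 * n + 2)

lemma auxAng_pos (n k : ℕ) : 0 < auxAng n k := by
  unfold auxAng; positivity

lemma auxAng_lt (n k : ℕ) (hk : k ≤ n) : auxAng n k < π := by
  unfold auxAng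
  rw [div_lt_iff₀ (by positivity)]
  have : (k : ℝ) ≤ n := by exact_mod_cast hk
  nlinarith [pi_pos]

lemma auxAng_mul (n k : ℕ) : ((n : ℝ) + 1) * auxAng n k = k * π + π / 2 := by
  unfold auxAng; field_simp

lemma aux_injective (n : ℕ) (nodes : Fin (n + 1) → ℝ)
    (hnodes : ∀ k : Fin (n + 1), nodes k = cos (auxAng n k)) :
    Function.Injective nodes := by
  intro i j hij
  rw [hnodes, hnodes] at hij
  have := injOn_cos ⟨(auxAng_pos n i).le, (auxAng_lt n i (by omega)).le⟩
    ⟨(auxAng_pos n j).le, (auxAng_lt n j (by omega)).le⟩ hij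
  have h2 : ((n : ℝ) + 1) * auxAng n i = ((n : ℝ) + 1) * auxAng n j := by rw [this]
  rw [auxAng_mul, auxAng_mul] at h2
  have h3 : ((i : ℕ) : ℝ) = (j : ℕ) := by
    apply mul_right_cancel₀ pi_ne_zero; linarith
  exact Fin.ext (by exact_mod_cast h3)

lemma aux_cos_zero (n k : ℕ) : cos (((n : ℝ) + 1) * auxAng n k) = 0 := by
  rw [auxAng_mul, cos_add_pi_div_two, sin_nat_mul_pi, neg_zero]

lemma aux_nodal (n : ℕ) (nodes : Fin (n + 1) → ℝ)
    (hnodes : ∀ k : Fin (n + 1), nodes k = cos (auxAng n k)) :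
    Chebyshev.T ℝ ((n + 1 : ℕ) : ℤ) = C ((2 : ℝ) ^ n) * Lagrange.nodal Finset.univ nodes := by
  have hinj := aux_injective n nodes hnodes
  have hd : (Chebyshev.T ℝ ((n + 1 : ℕ) : ℤ)).degree = ((n + 1 : ℕ) : WithBot ℕ) := by
    rw [Chebyshev.degree_T, Int.natAbs_natCast]
  have hne : (2 : ℝ) ^ n ≠ 0 := by positivity
  refine Polynomial.eq_of_degree_sub_lt_of_eval_index_eq Finset.univ
    (v := nodes) hinj.injOn ?_ ?_
  · have := Polynomial.degree_sub_lt_left (p := Chebyshev.T ℝ ((n + 1 : ℕ) : ℤ))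
      (q := C ((2 : ℝ) ^ n) * Lagrange.nodal Finset.univ nodes) ?_ ?_ ?_
    · rw [hd] at this; simpa using this
    · rw [hd, degree_C_mul hne, Lagrange.degree_nodal]; simp
    · intro h; rw [h] at hd; simp at hd
      exact absurd hd (by exact WithBot.bot_ne_coe)
    · rw [leadingCoeff_mul, Lagrange.nodal_monic.leadingCoeff, Chebyshev.leadingCoeff_T]
      simp only [leadingCoeff_C, mul_one]
      congr 1
  · intro i _
    rw [eval_mul, Lagrange.eval_nodal_at_node (Finset.mem_univ i), mul_zero, hnodes,
      Chebyshev.T_real_cos]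
    have := aux_cos_zero n i
    push_cast
    exact this

lemma aux_basis (n : ℕ) (nodes : Fin (n + 1) → ℝ)
    (hnodes : ∀ k : Fin (n + 1), nodes k = cos (auxAng n k)) (k : Fin (n + 1))
    {a : ℝ} (ha0 : 0 ≤ a) (ha1 : a ≤ π) :
    |(Lagrange.basis Finset.univ nodes k).eval (cos a)| * (((n : ℝ) + 1) * |a - auxAng n k|)
      ≤ 2 * |cos (((n : ℝ) + 1) * a)| := by
  have hinj := aux_injective n nodes hnodes
  by_cases hx : cos a = nodes k
  · have : a = auxAng n k := injOn_cos ⟨ha0, ha1⟩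
      ⟨(auxAng_pos n k).le, (auxAng_lt n k (by omega)).le⟩ (by rw [hx, hnodes])
    rw [this]; simp
  have hT := aux_nodal n nodes hnodes
  have h1 : cos (((n : ℝ) + 1) * a) = 2 ^ n * (Lagrange.nodal Finset.univ nodes).eval (cos a) := by
    have := congrArg (eval (cos a)) hT
    rw [Chebyshev.T_real_cos, eval_mul, eval_C] at this
    rw [← this]; push_cast; rfl
  have h2 : |2 ^ n * (derivative (Lagrange.nodal Finset.univ nodes)).eval (nodes k)| *
      sin (auxAng n k) = n + 1 := by
    have := congrArg (fun q => eval (nodes k) (derivative q)) hT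
    simp only [derivative_C_mul, eval_mul, eval_C, Chebyshev.T_derivative_eq_U] at this
    rw [← this, ← abs_of_pos (sin_pos_of_pos_of_lt_pi (auxAng_pos n k) (auxAng_lt n k (by omega))),
      ← abs_mul, mul_assoc, hnodes, Chebyshev.U_real_cos]
    have e : (((((n + 1 : ℕ) : ℤ) - 1 : ℤ) : ℝ) + 1) * auxAng n k = k * π + π / 2 := by
      rw [← auxAng_mul]; push_cast; ring
    rw [e, sin_add_pi_div_two, abs_mul, cos_nat_mul_pi]
    simp
    positivity
  have hsin := sin_pos_of_pos_of_lt_pi (auxAng_pos n k) (auxAng_lt n k (by omega))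
  have htrig := aux_trig ha0 ha1 (auxAng_pos n k).le (auxAng_lt n k (by omega)).le
  rw [← hnodes] at htrig
  have hx' : 0 < |cos a - nodes k| := abs_pos.2 (sub_ne_zero.2 hx)
  rw [Lagrange.eval_basis_not_at_node (Finset.mem_univ k) hx,
    Lagrange.nodalWeight_eq_eval_derivative_nodal (Finset.mem_univ k), h1]
  set D := (derivative (Lagrange.nodal Finset.univ nodes)).eval (nodes k)
  set P := (Lagrange.nodal Finset.univ nodes).eval (cos a)
  have hD : 0 < |D| := by
    apply abs_pos.2; intro h; rw [h] at h2; simp at h2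
    have : (0 : ℝ) < n + 1 := by positivity
    linarith
  rw [← h2, abs_mul, abs_mul, abs_inv, abs_inv, abs_mul, abs_mul]
  have h2n : |(2 : ℝ) ^ n| = 2 ^ n := abs_of_pos (by positivity)
  rw [h2n]
  have : |P| * (|D|⁻¹ * |cos a - nodes k|⁻¹) * (2 ^ n * |D| * sin (auxAng n k) * |a - auxAng n k|)
      = |P| * 2 ^ n * (sin (auxAng n k) * |a - auxAng n k|) / |cos a - nodes k| := by
    field_simp
  rw [this, div_le_iff₀ hx']
  have := mul_le_mul_of_nonneg_left htrig (by positivity : 0 ≤ |P| * 2 ^ n)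
  linarith

lemma aux_basis_two (n : ℕ) (nodes : Fin (n + 1) → ℝ)
    (hnodes : ∀ k : Fin (n + 1), nodes k = cos (auxAng n k)) (k : Fin (n + 1))
    {a : ℝ} (ha0 : 0 ≤ a) (ha1 : a ≤ π) :
    |(Lagrange.basis Finset.univ nodes k).eval (cos a)| ≤ 2 := by
  by_cases h : a = auxAng n k
  · rw [h, ← hnodes, Lagrange.eval_basis_self (aux_injective n nodes hnodes).injOn
      (Finset.mem_univ k)]; norm_num
  have hb := aux_basis n nodes hnodes k ha0 ha1
  have hc := abs_cos_sub_cos_le (((n : ℝ) + 1) * a) (((n : ℝ) + 1) * auxAng n k)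
  rw [aux_cos_zero, sub_zero, ← mul_sub, abs_mul, abs_of_pos (by positivity : (0 : ℝ) < n + 1)] at hc
  have hp : 0 < ((n : ℝ) + 1) * |a - auxAng n k| :=
    mul_pos (by positivity) (abs_pos.2 (sub_ne_zero.2 h))
  exact le_of_mul_le_mul_right (by linarith) hp

/-- The majorant. -/
noncomputable def auxW : ℕ → ℝ
  | 0 => 2
  | 1 => 2
  | (m + 2) => 2 / π * ((m + 1 : ℕ) : ℝ)⁻¹

lemma auxW_nonneg (m : ℕ) : 0 ≤ auxW m := by
  match m with
  | 0 => norm_num [auxW]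
  | 1 => norm_num [auxW]
  | (m + 2) => unfold auxW; positivity

lemma aux_basis_far (n : ℕ) (nodes : Fin (n + 1) → ℝ)
    (hnodes : ∀ k : Fin (n + 1), nodes k = cos (auxAng n k)) (k : Fin (n + 1))
    {a : ℝ} (ha0 : 0 ≤ a) (ha1 : a ≤ π) (m : ℕ)
    (hm : (((m : ℝ) - 1) * π) ≤ ((n : ℝ) + 1) * |a - auxAng n k|) :
    |(Lagrange.basis Finset.univ nodes k).eval (cos a)| ≤ auxW m := by
  match m, hm with
  | 0, _ => exact aux_basis_two n nodes hnodes k ha0 ha1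
  | 1, _ => exact aux_basis_two n nodes hnodes k ha0 ha1
  | (m + 2), hm =>
    have hb := aux_basis n nodes hnodes k ha0 ha1
    have hc := abs_cos_le_one (((n : ℝ) + 1) * a)
    have h1 := mul_le_mul_of_nonneg_left hm
      (abs_nonneg ((Lagrange.basis Finset.univ nodes k).eval (cos a)))
    have : auxW (m + 2) = 2 / (((m : ℝ) + 1) * π) := by
      simp only [auxW]; push_cast; field_simp
    rw [this, le_div_iff₀ (by positivity)]
    push_cast at h1
    have e : (m : ℝ) + 2 - 1 = m + 1 := by ring
    rw [e] at h1
    linarith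

lemma aux_sumW (n : ℕ) (hn : 1 ≤ n) :
    ∑ i ∈ Finset.range n, auxW (i + 1) ≤ 2 + 2 / π * (1 + log n) := by
  obtain ⟨m, rfl⟩ : ∃ m, n = m + 1 := ⟨n - 1, by omega⟩
  rw [Finset.sum_range_succ']
  have h := harmonic_le_one_add_log m
  have hl : log m ≤ log ((m + 1 : ℕ) : ℝ) := by
    rcases Nat.eq_zero_or_pos m with h0 | h0
    · subst h0; simp
    · exact log_le_log (by exact_mod_cast h0) (by push_cast; linarith)
  have e : ∑ i ∈ Finset.range m, auxW (i + 1 + 1) = 2 / π * (harmonic m : ℝ) := by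
    simp only [auxW, harmonic, ← Finset.mul_sum]
    push_cast
    rfl
  rw [e]
  have e2 : auxW (0 + 1) = 2 := rfl
  rw [e2]
  have := mul_le_mul_of_nonneg_left (h.trans (add_le_add_right hl 1)) (by positivity : 0 ≤ 2 / π)
  linarith

lemma aux_lebesgue (n : ℕ) (hn : 2 ≤ n) (nodes : Fin (n + 1) → ℝ)
    (hnodes : ∀ k : Fin (n + 1), nodes k = cos (auxAng n k))
    {a : ℝ} (ha0 : 0 ≤ a) (ha1 : a ≤ π) :
    ∑ k, |(Lagrange.basis Finset.univ nodes k).eval (cos a)| ≤ 8 + 4 / π * log n := by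
  obtain ⟨j, hj, hj1, hj2⟩ : ∃ j : ℕ, j ≤ n ∧ (j : ℝ) * π ≤ ((n : ℝ) + 1) * a ∧
      ((n : ℝ) + 1) * a ≤ (j + 1) * π := by
    by_cases h : a = π
    · exact ⟨n, le_rfl, by rw [h]; nlinarith [pi_pos], by rw [h]⟩
    · have hlt : a < π := lt_of_le_of_ne ha1 h
      have hnn : 0 ≤ ((n : ℝ) + 1) * a / π := by positivity
      refine ⟨⌊((n : ℝ) + 1) * a / π⌋₊, ?_, ?_, ?_⟩
      · apply Nat.lt_succ_iff.1
        rw [Nat.floor_lt hnn, div_lt_iff₀ pi_pos]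
        push_cast
        have : (0 : ℝ) < n + 1 := by positivity
        nlinarith
      · rw [← le_div_iff₀ pi_pos]; exact Nat.floor_le hnn
      · rw [← div_le_iff₀ pi_pos]; exact (Nat.lt_floor_add_one _).le
  have hN : (0 : ℝ) < n + 1 := by positivity
  have key : ∀ k : Fin (n + 1), |(Lagrange.basis Finset.univ nodes k).eval (cos a)| ≤
      (fun k : ℕ => if k < j then auxW (j - k) else auxW (k - j)) k := by
    intro k
    have hm := auxAng_mul n k
    have hp := pi_pos
    dsimp only
    split_ifs with h
    · apply aux_basis_far n nodes hnodes k ha0 ha1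
      rw [Nat.cast_sub h.le]
      have := mul_le_mul_of_nonneg_left (le_abs_self (a - auxAng n k)) hN.le
      nlinarith
    · push Not at h
      apply aux_basis_far n nodes hnodes k ha0 ha1
      rw [Nat.cast_sub h]
      have := mul_le_mul_of_nonneg_left (neg_le_abs (a - auxAng n k)) hN.le
      nlinarith
  refine (Finset.sum_le_sum fun k _ => key k).trans ?_
  rw [Fin.sum_univ_eq_sum_range (fun k : ℕ => if k < j then auxW (j - k) else auxW (k - j)), ← Finset.sum_range_add_sum_Ico _ (by omega : j ≤ n + 1)]
  have s1 : ∑ k ∈ Finset.range j, (if k < j then auxW (j - k) else auxW (k - j)) ≤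
      ∑ i ∈ Finset.range n, auxW (i + 1) := by
    rw [← Finset.sum_range_reflect]
    calc _ = ∑ i ∈ Finset.range j, auxW (i + 1) := by
          apply Finset.sum_congr rfl
          intro i hi
          have := Finset.mem_range.1 hi
          rw [if_pos (by omega)]
          congr 1; omega
      _ ≤ _ := Finset.sum_le_sum_of_subset_of_nonneg
          (Finset.range_subset_range.2 hj) fun i _ _ => auxW_nonneg _
  have s2 : ∑ k ∈ Finset.Ico j (n + 1), (if k < j then auxW (j - k) else auxW (k - j)) ≤
      ∑ i ∈ Finset.range n, auxW (i + 1) + 2 := by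
    rw [Finset.sum_Ico_eq_sum_range]
    calc _ = ∑ i ∈ Finset.range (n + 1 - j), auxW i := by
          apply Finset.sum_congr rfl
          intro i hi
          rw [if_neg (by omega)]
          congr 1; omega
      _ ≤ ∑ i ∈ Finset.range (n + 1), auxW i := Finset.sum_le_sum_of_subset_of_nonneg
          (Finset.range_subset_range.2 (by omega)) fun i _ _ => auxW_nonneg _
      _ = _ := by rw [Finset.sum_range_succ']; rfl
  have s3 := aux_sumW n (by omega)
  have h4 : 4 / π * (1 + log n) = 2 / π * (1 + log n) + 2 / π * (1 + log n) := by ring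
  have h5 : 4 / π ≤ 2 := by
    rw [div_le_iff₀ pi_pos]; linarith [pi_gt_three]
  linarith

/-- Lebesgue-type bound for interpolation at Chebyshev nodes: the uniform
interpolation error at the `n+1` Chebyshev nodes is at most
`(9 + (4/π) * log n)` times the error of best uniform approximation by
polynomials of degree at most `n`. -/
theorem chebyshev_interpolation_near_best (n : ℕ) (hn : 2 ≤ n) (f : ℝ → ℝ)
    (hf : ContinuousOn f (Set.Icc (-1 : ℝ) 1))
    (nodes : Fin (n + 1) → ℝ)
    (hnodes : ∀ k : Fin (n + 1),
      nodes k = Real.cos ((2 * (k : ℕ) + 1) * π / (2 * n + 2)))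
    (p : ℝ[X])
    (hp : p = Lagrange.interpolate Finset.univ nodes (fun k => f (nodes k))) :
    sSup ((fun x => |f x - p.eval x|) '' Set.Icc (-1 : ℝ) 1) ≤
      (9 + (4 / π) * Real.log n) *
        sInf {e : ℝ | ∃ q : ℝ[X], q.natDegree ≤ n ∧
          e = sSup ((fun x => |f x - q.eval x|) '' Set.Icc (-1 : ℝ) 1)} := by
  have hn1 : (1 : ℝ) ≤ n := by exact_mod_cast (by omega : 1 ≤ n)
  have hlog : 0 ≤ log n := log_nonneg hn1
  have hCpos : 0 < 9 + (4 / π) * Real.log n := by positivity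
  have hang : ∀ k : Fin (n + 1), nodes k = cos (auxAng n k) := hnodes
  have hinj := aux_injective n nodes hang
  rw [mul_comm, ← div_le_iff₀ hCpos]
  apply le_csInf
  · exact ⟨_, 0, by simp, rfl⟩
  rintro e ⟨q, hq, rfl⟩
  rw [div_le_iff₀ hCpos]
  set M := sSup ((fun x => |f x - q.eval x|) '' Set.Icc (-1 : ℝ) 1) with hM
  have hcont : ContinuousOn (fun x => |f x - q.eval x|) (Set.Icc (-1 : ℝ) 1) :=
    (hf.sub q.continuous.continuousOn).abs
  have hbdd := (isCompact_Icc.image_of_continuousOn hcont).bddAbove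
  have hle : ∀ x ∈ Set.Icc (-1 : ℝ) 1, |f x - q.eval x| ≤ M := fun x hx =>
    le_csSup hbdd ⟨x, hx, rfl⟩
  have hM0 : 0 ≤ M := (abs_nonneg _).trans (hle 0 (by constructor <;> norm_num))
  apply csSup_le
  · exact ⟨_, 0, by constructor <;> norm_num, rfl⟩
  rintro _ ⟨x, hx, rfl⟩
  dsimp only
  have hqi : q = Lagrange.interpolate Finset.univ nodes (fun k => q.eval (nodes k)) := by
    apply Lagrange.eq_interpolate hinj.injOn
    rw [Finset.card_univ, Fintype.card_fin]
    exact lt_of_le_of_lt degree_le_natDegree (by exact_mod_cast Nat.lt_succ_of_le hq)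
  have hpq : p.eval x - q.eval x = ∑ k, (f (nodes k) - q.eval (nodes k)) *
      (Lagrange.basis Finset.univ nodes k).eval x := by
    conv_lhs => rw [hp, hqi]
    rw [← eval_sub, ← map_sub, Lagrange.interpolate_apply, eval_finsetSum]
    simp
  have hL := aux_lebesgue n hn nodes hang (arccos_nonneg x) (arccos_le_pi x)
  rw [cos_arccos hx.1 hx.2] at hL
  have hb : |p.eval x - q.eval x| ≤ M * (8 + 4 / π * log n) := by
    rw [hpq]
    refine (Finset.abs_sum_le_sum_abs _ _).trans ?_
    refine le_trans ?_ (mul_le_mul_of_nonneg_left hL hM0)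
    rw [Finset.mul_sum]
    apply Finset.sum_le_sum
    intro k _
    rw [abs_mul]
    apply mul_le_mul_of_nonneg_right _ (abs_nonneg _)
    apply hle
    rw [hnodes]
    exact ⟨neg_one_le_cos _, cos_le_one _⟩
  have ht : |f x - p.eval x| ≤ |f x - q.eval x| + |p.eval x - q.eval x| := by
    rw [abs_sub_comm (p.eval x)]
    exact abs_sub_le _ _ _
  have := hle x hx
  linarith
end

section
/- Let ν ≥ 1 be an integer and let f : [-1,1] → ℝ be ν times differentiable such that its ν-th derivative f^{(ν)} has bounded total variation V on [-1,1]. For each integer n > ν, let p_n be the unique polynomial of degree at most n interpolating f at the n+1 Chebyshev nodes cos((2k+1)π/(2n+2)), k = 0, …, n. Then sup_{x ∈ [-1,1]} |f(x) - p_n(x)| ≤ 4V / (π ν (n - ν)^ν). -/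
open Real Set Polynomial

lemma bv_intervalIntegrable {u : ℝ → ℝ} {a b : ℝ} (hab : a ≤ b) (hu : BoundedVariationOn u (Icc a b)) :
    IntervalIntegrable u MeasureTheory.volume a b := by
  obtain ⟨p, q, hp, hq, h⟩ := hu.locallyBoundedVariationOn.exists_monotoneOn_sub_monotoneOn
  rw [h]
  rw [← uIcc_of_le hab] at hp hq
  exact hp.intervalIntegrable.sub hq.intervalIntegrable

lemma bv_piece {u : ℝ → ℝ} {a b : ℝ} (hab : a ≤ b) (hu : BoundedVariationOn u (Icc a b))
    (k : ℕ) (hk : 1 ≤ k) :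
    |(∫ t in a..b, u t * cos (k * t)) - (u b * (sin (k * b) / k) - u a * (sin (k * a) / k))|
      ≤ (eVariationOn u (Icc a b)).toReal * (1 / k + (b - a)) := by
  have hk0 : (0 : ℝ) < k := by exact_mod_cast hk
  have hui := bv_intervalIntegrable hab hu
  have hc : ContinuousOn (fun t : ℝ => cos (k * t)) (uIcc a b) := by fun_prop
  have hG : ∫ t in a..b, cos (k * t) = sin (k * b) / k - sin (k * a) / k := by
    rw [intervalIntegral.integral_comp_mul_left (fun t => cos t) hk0.ne', integral_cos, smul_eq_mul]
    field_simp
  have h1 : ∫ t in a..b, (u t - u a) * cos (k * t)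
      = (∫ t in a..b, u t * cos (k * t)) - u a * (sin (k * b) / k - sin (k * a) / k) := by
    rw [← hG, ← intervalIntegral.integral_const_mul, ← intervalIntegral.integral_sub]
    · congr 1; ext t; ring
    · exact hui.mul_continuousOn hc
    · exact (hc.intervalIntegrable).const_mul _
  have hd : ∀ t ∈ Icc a b, |u t - u a| ≤ (eVariationOn u (Icc a b)).toReal := fun t ht => by
    have := hu.dist_le ht (left_mem_Icc.2 hab)
    rwa [Real.dist_eq] at this
  have h2 : |∫ t in a..b, (u t - u a) * cos (k * t)|
      ≤ (eVariationOn u (Icc a b)).toReal * (b - a) := by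
    have := intervalIntegral.norm_integral_le_of_norm_le_const (a := a) (b := b)
      (f := fun t => (u t - u a) * cos (k * t)) (C := (eVariationOn u (Icc a b)).toReal) ?_
    · rwa [Real.norm_eq_abs, abs_of_nonneg (sub_nonneg.2 hab)] at this
    · intro t ht
      rw [uIoc_of_le hab] at ht
      rw [norm_mul, Real.norm_eq_abs, Real.norm_eq_abs]
      have h3 := hd t ⟨ht.1.le, ht.2⟩
      calc _ ≤ |u t - u a| * 1 := by gcongr; exact abs_cos_le_one _
        _ ≤ _ := by simpa using h3
  have h3 : |(u b - u a) * (sin (k * b) / k)| ≤ (eVariationOn u (Icc a b)).toReal * (1 / k) := by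
    rw [abs_mul, abs_div, abs_of_pos hk0]
    gcongr
    · exact hd b (right_mem_Icc.2 hab)
    · exact abs_sin_le_one _
  have : (∫ t in a..b, u t * cos (k * t)) - (u b * (sin (k * b) / k) - u a * (sin (k * a) / k))
     = (∫ t in a..b, (u t - u a) * cos (k * t)) - (u b - u a) * (sin (k * b) / k) := by
    rw [h1]; ring
  rw [this]
  refine (abs_sub _ _).trans ?_
  linarith

lemma bv_base {u : ℝ → ℝ} (hu : BoundedVariationOn u (Icc 0 π)) (k : ℕ) (hk : 1 ≤ k) :
    |∫ t in (0:ℝ)..π, u t * cos (k * t)| ≤ (eVariationOn u (Icc 0 π)).toReal / k := by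
  have hk0 : (0 : ℝ) < k := by exact_mod_cast hk
  set W := (eVariationOn u (Icc 0 π)).toReal with hW
  have key : ∀ M : ℕ, |∫ t in (0:ℝ)..π, u t * cos (k * t)| ≤ W * (1 / k + π / ((M : ℝ) + 1)) := by
    intro M
    set x : ℕ → ℝ := fun i => i * (π / ((M : ℝ) + 1)) with hx
    have hpos : 0 < π / ((M : ℝ) + 1) := by positivity
    have hmono : Monotone x := fun i j h => by
      simp only [hx]; gcongr
    have x0 : x 0 = 0 := by simp [hx]
    have xM : x (M + 1) = π := by simp only [hx]; push_cast; field_simp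
    have hsub : ∀ i ∈ Finset.range (M + 1), Icc (x i) (x (i + 1)) ⊆ Icc 0 π := fun i hi => by
      rw [← x0, ← xM]
      exact Icc_subset_Icc (hmono (Nat.zero_le _)) (hmono (Finset.mem_range.1 hi))
    have hbv : ∀ i ∈ Finset.range (M + 1), BoundedVariationOn u (Icc (x i) (x (i + 1))) :=
      fun i hi => hu.mono (hsub i hi)
    have hsum : ∑ i ∈ Finset.range (M + 1), (eVariationOn u (Icc (x i) (x (i + 1)))).toReal = W := by
      rw [hW, ← ENNReal.toReal_sum (fun i hi => hbv i hi), eVariationOn.sum' u hmono, x0, xM]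
    have hint : ∑ i ∈ Finset.range (M + 1), (∫ t in (x i)..(x (i + 1)), u t * cos (k * t))
        = ∫ t in (0:ℝ)..π, u t * cos (k * t) := by
      rw [intervalIntegral.sum_integral_adjacent_intervals, x0, xM]
      intro i hi
      exact (bv_intervalIntegrable (hmono (Nat.le_succ i)) (hbv i (Finset.mem_range.2 hi))).mul_continuousOn
        (by fun_prop)
    have htel : ∑ i ∈ Finset.range (M + 1), (u (x (i+1)) * (sin (k * x (i+1)) / k) - u (x i) * (sin (k * x i) / k)) = 0 := by
      rw [Finset.sum_range_sub (fun i => u (x i) * (sin (k * x i) / k)), x0, xM]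
      simp
    calc _ = |∑ i ∈ Finset.range (M + 1), ((∫ t in (x i)..(x (i + 1)), u t * cos (k * t)) -
          (u (x (i+1)) * (sin (k * x (i+1)) / k) - u (x i) * (sin (k * x i) / k)))| := by
          rw [Finset.sum_sub_distrib, htel, hint, sub_zero]
      _ ≤ ∑ i ∈ Finset.range (M + 1), (eVariationOn u (Icc (x i) (x (i + 1)))).toReal * (1 / k + π / ((M : ℝ) + 1)) := by
          refine (Finset.abs_sum_le_sum_abs _ _).trans (Finset.sum_le_sum fun i hi => ?_)
          have h := bv_piece (hmono (Nat.le_succ i)) (hbv i hi) k hk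
          have e : x (i + 1) - x i = π / ((M : ℝ) + 1) := by simp only [hx]; push_cast; ring
          rwa [Nat.succ_eq_add_one, e] at h
      _ = _ := by rw [← Finset.sum_mul, hsum]
  have lim : Filter.Tendsto (fun M : ℕ => W * (1 / k + π / ((M : ℝ) + 1))) Filter.atTop (nhds (W * (1 / k + 0))) := by
    refine Filter.Tendsto.const_mul _ (Filter.Tendsto.const_add _ ?_)
    have := (tendsto_one_div_add_atTop_nhds_zero_nat (𝕜 := ℝ)).const_mul π
    simpa [div_eq_mul_inv] using this
  have := ge_of_tendsto' lim key
  rwa [add_zero, mul_one_div] at this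

lemma bv_base_cos {h : ℝ → ℝ} (hb : BoundedVariationOn h (Icc (-1) 1)) :
    BoundedVariationOn (fun t => h (cos t)) (Icc 0 π) ∧
    eVariationOn (fun t => h (cos t)) (Icc 0 π) ≤ eVariationOn h (Icc (-1) 1) := by
  have := eVariationOn.comp_le_of_antitoneOn h (s := Icc (-1) 1) (t := Icc 0 π) cos strictAntiOn_cos.antitoneOn
    (fun t _ => cos_mem_Icc t)
  exact ⟨ne_top_of_le_ne_top hb this, this⟩

/-- integration by parts -/
lemma coeff_rec {h h' : ℝ → ℝ} (hd : ∀ x ∈ Icc (-1:ℝ) 1, HasDerivWithinAt h (h' x) (Icc (-1) 1) x)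
    (hi : IntervalIntegrable (fun t => h' (cos t)) MeasureTheory.volume 0 π) (k : ℕ) :
    ∫ t in (0:ℝ)..π, h (cos t) * cos ((k + 1 : ℕ) * t) =
      ((∫ t in (0:ℝ)..π, h' (cos t) * cos (k * t)) - ∫ t in (0:ℝ)..π, h' (cos t) * cos ((k + 2 : ℕ) * t)) / (2 * (k + 1)) := by
  have hk : (0:ℝ) < k + 1 := by positivity
  have hc : Continuous (fun t => h (cos t)) := by
    have : ContinuousOn h (Icc (-1) 1) := fun x hx => (hd x hx).continuousWithinAt
    exact this.comp_continuous continuous_cos cos_mem_Icc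
  have hmul : ∀ g : ℝ → ℝ, Continuous g → IntervalIntegrable (fun t => h' (cos t) * g t) MeasureTheory.volume 0 π :=
    fun g hg => hi.mul_continuousOn hg.continuousOn
  have hcc : IntervalIntegrable (fun t => h (cos t) * cos ((k + 1 : ℕ) * t)) MeasureTheory.volume 0 π :=
    (hc.mul (by fun_prop)).intervalIntegrable _ _
  have i1 := hmul (fun t => sin t * sin ((k + 1 : ℕ) * t) / (k + 1)) (by fun_prop)
  have ftc := intervalIntegral.integral_eq_sub_of_hasDerivAt_of_le pi_pos.le
    (f := fun t => h (cos t) * (sin ((k + 1 : ℕ) * t) / (k + 1)))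
    (f' := fun t => h (cos t) * cos ((k + 1 : ℕ) * t) - h' (cos t) * (sin t * sin ((k + 1 : ℕ) * t) / (k + 1)))
    (hc.mul (by fun_prop)).continuousOn ?_ (hcc.sub i1)
  · rw [intervalIntegral.integral_sub hcc i1] at ftc
    have e0 : sin ((k + 1 : ℕ) * π) = 0 := sin_nat_mul_pi _
    simp only [e0, mul_zero, sin_zero, zero_div, sub_zero] at ftc
    have := sub_eq_zero.1 ftc
    rw [this, ← intervalIntegral.integral_sub (hmul _ (by fun_prop)) (hmul _ (by fun_prop)), ← intervalIntegral.integral_div]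
    congr 1; ext t
    have a1 : ((k:ℝ)) * t = (k+1) * t - t := by ring
    have a2 : (((k + 2 : ℕ):ℝ)) * t = (k+1) * t + t := by push_cast; ring
    rw [a1, a2, cos_sub, cos_add]
    push_cast
    field_simp
    ring
  · intro t ht
    have hct : cos t ∈ Ioo (-1:ℝ) 1 := by
      constructor
      · rw [← cos_pi]; exact cos_lt_cos_of_nonneg_of_le_pi ht.1.le le_rfl ht.2
      · rw [← cos_zero]; exact cos_lt_cos_of_nonneg_of_le_pi le_rfl ht.2.le ht.1
    have d1 : HasDerivAt h (h' (cos t)) (cos t) :=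
      (hd _ (Ioo_subset_Icc_self hct)).hasDerivAt (Icc_mem_nhds hct.1 hct.2)
    have d2 := d1.comp t (hasDerivAt_cos t)
    have d3 : HasDerivAt (fun t => sin ((k + 1 : ℕ) * t) / ((k:ℝ) + 1)) (cos ((k + 1 : ℕ) * t)) t := by
      have := (((hasDerivAt_id t).const_mul (((k+1:ℕ):ℝ))).sin).div_const ((k:ℝ)+1)
      convert! this using 1
      push_cast
      simp only [id]
      field_simp
    convert! d2.mul d3 using 1
    simp only [Function.comp]
    ring

lemma coeff_bound (ν : ℕ) : ∀ (g : ℕ → ℝ → ℝ)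
    (_ : ∀ i < ν, ∀ x ∈ Icc (-1:ℝ) 1, HasDerivWithinAt (g i) (g (i + 1) x) (Icc (-1) 1) x)
    (_ : BoundedVariationOn (g ν) (Icc (-1) 1)) (k : ℕ) (_ : ν < k),
    |∫ t in (0:ℝ)..π, g 0 (cos t) * cos (k * t)| ≤
      (eVariationOn (g ν) (Icc (-1) 1)).toReal / (k.descFactorial (ν + 1)) := by
  induction ν with
  | zero =>
    intro g _ hb k hk
    obtain ⟨h1, h2⟩ := bv_base_cos hb
    refine (bv_base h1 k hk).trans ?_
    rw [zero_add, Nat.descFactorial_one]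
    exact div_le_div_of_nonneg_right (ENNReal.toReal_mono hb h2) (Nat.cast_nonneg k)
  | succ ν ih =>
    intro g hd hb k hk
    obtain ⟨k, rfl⟩ : ∃ m, k = m + 1 := ⟨k - 1, by omega⟩
    have ih' := ih (fun i => g (i + 1)) (fun i hi => hd (i + 1) (by omega)) hb
    have hi : IntervalIntegrable (fun t => g 1 (cos t)) MeasureTheory.volume 0 π := by
      rcases Nat.eq_zero_or_pos ν with h0 | h0
      · subst h0
        exact bv_intervalIntegrable pi_pos.le (bv_base_cos hb).1
      · have : ContinuousOn (g 1) (Icc (-1) 1) := fun x hx => (hd 1 (by omega) x hx).continuousWithinAt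
        exact (this.comp_continuous continuous_cos cos_mem_Icc).intervalIntegrable _ _
    rw [coeff_rec (hd 0 (by omega)) hi k]
    have b1 := ih' k (by omega)
    have b2 := ih' (k + 2) (by omega)
    simp only [zero_add] at b1 b2 ⊢
    set V := (eVariationOn (g (ν + 1)) (Icc (-1) 1)).toReal with hV
    have hV0 : 0 ≤ V := ENNReal.toReal_nonneg
    have hD : 0 < k.descFactorial (ν + 1) := Nat.pos_of_ne_zero (by rw [Ne, Nat.descFactorial_eq_zero_iff_lt]; omega)
    have hDR : (0:ℝ) < k.descFactorial (ν + 1) := by exact_mod_cast hD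
    have hle : V / ((k + 2).descFactorial (ν + 1)) ≤ V / (k.descFactorial (ν + 1)) := by
      have := Nat.descFactorial_le (ν + 1) (show k ≤ k + 2 by omega)
      gcongr
    rw [abs_div, abs_of_pos (by positivity : (0:ℝ) < 2 * (k + 1)), Nat.succ_descFactorial_succ]
    push_cast at b2 ⊢
    rw [div_le_iff₀ (by positivity)]
    refine (abs_sub _ _).trans ?_
    calc _ ≤ V / (k.descFactorial (ν + 1)) + V / (k.descFactorial (ν + 1)) := by linarith
      _ = _ := by field_simp; ring

lemma fourier_expand {F : ℝ → ℝ} (hF : Continuous F) (hper : Function.Periodic F (2 * π))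
    (heven : ∀ t, F (-t) = F t) (c : ℕ → ℝ)
    (hc : ∀ k : ℕ, c k = ∫ t in (0:ℝ)..π, F t * cos (k * t)) (hs : Summable c) (θ : ℝ) :
    HasSum (fun k : ℕ => 2 * c k / π * cos (k * θ)) (F θ + c 0 / π) := by
  have : Fact (0 < 2 * π) := ⟨two_pi_pos⟩
  have hG : Continuous (fun t => (F t : ℂ)) := Complex.continuous_ofReal.comp hF
  have hGp : Function.Periodic (fun t => (F t : ℂ)) (2 * π) := fun t => by simp only [hper t]
  let G : C(AddCircle (2 * π), ℂ) := ⟨hGp.lift, by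
    refine continuous_coinduced_dom.2 ?_
    exact hG⟩
  have hGv : ∀ t : ℝ, G (t : AddCircle (2 * π)) = F t := fun t => rfl
  have hfo : ∀ (n : ℤ) (t : ℝ), fourier n (t : AddCircle (2 * π)) = Complex.exp ((n * t : ℝ) * Complex.I) := by
    intro n t
    rw [fourier_coe_apply]
    congr 1
    push_cast
    have : (π : ℂ) ≠ 0 := by exact_mod_cast pi_ne_zero
    field_simp
  have hcoef : ∀ n : ℤ, fourierCoeff G n = ((c n.natAbs / π : ℝ) : ℂ) := by
    intro n
    rw [fourierCoeff_eq_intervalIntegral G n (-π)]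
    have e : -π + 2 * π = π := by ring
    rw [e]
    simp only [hfo, hGv, smul_eq_mul]
    have hci : ∀ a b, IntervalIntegrable (fun t : ℝ => Complex.exp (((-n : ℤ) * t : ℝ) * Complex.I) * F t) MeasureTheory.volume a b :=
      fun a b => Continuous.intervalIntegrable (by fun_prop) _ _
    rw [← intervalIntegral.integral_add_adjacent_intervals (hci (-π) 0) (hci 0 π)]
    have e2 : ∫ t in (-π)..0, Complex.exp (((-n : ℤ) * t : ℝ) * Complex.I) * F t
        = ∫ t in (0:ℝ)..π, Complex.exp (((-n : ℤ) * (-t) : ℝ) * Complex.I) * F (-t) := by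
      rw [intervalIntegral.integral_comp_neg (fun t : ℝ => Complex.exp (((-n : ℤ) * t : ℝ) * Complex.I) * F t)]
      simp
    rw [e2, ← intervalIntegral.integral_add]
    · have e3 : ∀ t : ℝ, Complex.exp (((-n : ℤ) * (-t) : ℝ) * Complex.I) * F (-t) + Complex.exp (((-n : ℤ) * t : ℝ) * Complex.I) * F t
          = ((2 * (F t * cos (n.natAbs * t)) : ℝ) : ℂ) := by
        intro t
        have : cos (n.natAbs * t) = cos (n * t) := by
          rw [Nat.cast_natAbs]
          rcases abs_choice n with h | h
          · rw [h]
          · rw [h]; push_cast; rw [neg_mul, cos_neg]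
        rw [heven, this]
        push_cast
        rw [Complex.cos]
        ring_nf
      simp only [e3]
      rw [intervalIntegral.integral_ofReal, intervalIntegral.integral_const_mul, ← hc, Complex.real_smul, ← Complex.ofReal_mul]
      congr 1
      field_simp
    · exact Continuous.intervalIntegrable (by fun_prop) _ _
    · exact hci _ _
  have hsum : Summable (fourierCoeff G) := by
    have h1 : Summable (fun k : ℕ => ((c k / π : ℝ) : ℂ)) := Complex.ofRealCLM.summable (hs.div_const π)
    refine Summable.of_nat_of_neg ?_ ?_
    · simpa only [hcoef, Int.natAbs_natCast] using h1
    · simpa only [hcoef, Int.natAbs_neg, Int.natAbs_natCast] using h1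
  have H := (has_pointwise_sum_fourier_series_of_summable hsum (θ : AddCircle (2 * π))).nat_add_neg
  have H2 := Complex.reCLM.hasSum H
  convert H2 using 1
  · ext k
    simp only [hcoef, hfo, Int.natAbs_neg, Int.natAbs_natCast, smul_eq_mul, Complex.reCLM_apply,
      Complex.add_re, Complex.re_ofReal_mul, Complex.exp_ofReal_mul_I_re]
    push_cast
    rw [neg_mul, cos_neg]
    ring
  · simp only [hGv, hcoef, hfo, smul_eq_mul, Complex.reCLM_apply,
      Complex.add_re, Complex.re_ofReal_mul, Complex.exp_ofReal_mul_I_re, Complex.ofReal_re]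
    simp

lemma desc_tail (ν n : ℕ) (hν : 1 ≤ ν) (hn : ν < n) :
    Summable (fun m : ℕ => 1 / ((m + (n + 1)).descFactorial (ν + 1) : ℝ)) ∧
    ∑' m : ℕ, 1 / ((m + (n + 1)).descFactorial (ν + 1) : ℝ) ≤ 1 / (ν * ((n:ℝ) - ν) ^ ν) := by
  have hν0 : (0:ℝ) < ν := by exact_mod_cast hν
  have hD : ∀ m j : ℕ, j ≤ m → (0:ℝ) < m.descFactorial j := fun m j h => by
    have : m.descFactorial j ≠ 0 := by rw [Ne, Nat.descFactorial_eq_zero_iff_lt]; omega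
    exact_mod_cast Nat.pos_of_ne_zero this
  have step : ∀ m : ℕ, 1 / ((m + (n + 1)).descFactorial (ν + 1) : ℝ)
      = 1 / (ν * ((m + n).descFactorial ν : ℝ)) - 1 / (ν * ((m + 1 + n).descFactorial ν : ℝ)) := by
    intro m
    have p1 := hD (m + n) ν (by omega)
    have p2 := hD (m + n + 1) ν (by omega)
    have e1 : ((m + n + 1).descFactorial (ν + 1) : ℝ) = (m + n + 1) * (m + n).descFactorial ν := by
      rw [Nat.succ_descFactorial_succ]; push_cast; ring
    have e2 : ((m + n + 1).descFactorial (ν + 1) : ℝ) = (m + n + 1 - ν) * (m + n + 1).descFactorial ν := by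
      rw [Nat.descFactorial_succ]; push_cast [Nat.cast_sub (show ν ≤ m + n + 1 by omega)]; ring
    have p3 := hD (m + n + 1) (ν + 1) (by omega)
    have h3 : m + (n + 1) = m + n + 1 := by ring
    have h4 : m + 1 + n = m + n + 1 := by ring
    rw [h3, h4]
    set D := ((m + n + 1).descFactorial (ν + 1) : ℝ)
    have f1 : 1 / (ν * ((m + n).descFactorial ν : ℝ)) = (m + n + 1) / (ν * D) := by
      rw [e1]; field_simp
    have f2 : 1 / (ν * ((m + n + 1).descFactorial ν : ℝ)) = (m + n + 1 - ν) / (ν * D) := by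
      have : (0:ℝ) < m + n + 1 - ν := by
        have : (ν:ℝ) < n := by exact_mod_cast hn
        have : (0:ℝ) ≤ m := by positivity
        linarith
      rw [e2]; field_simp
    rw [f1, f2]; field_simp; ring
  have bound : ∀ N, ∑ m ∈ Finset.range N, 1 / ((m + (n + 1)).descFactorial (ν + 1) : ℝ) ≤ 1 / (ν * ((n:ℝ) - ν) ^ ν) := by
    intro N
    simp only [step]
    rw [Finset.sum_range_sub' (fun m => 1 / (ν * ((m + n).descFactorial ν : ℝ)))]
    have q1 : 0 ≤ 1 / (ν * ((N + n).descFactorial ν : ℝ)) := by positivity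
    have q2 : 1 / (ν * ((0 + n).descFactorial ν : ℝ)) ≤ 1 / (ν * ((n:ℝ) - ν) ^ ν) := by
      have hlt : (0:ℝ) < n - ν := by
        have : (ν:ℝ) < n := by exact_mod_cast hn
        linarith
      have := Nat.pow_sub_le_descFactorial n ν
      have h5 : ((n:ℝ) - ν) ^ ν ≤ n.descFactorial ν := by
        have h6 : ((n + 1 - ν : ℕ) : ℝ) ^ ν ≤ n.descFactorial ν := by exact_mod_cast this
        refine le_trans ?_ h6
        gcongr
        rw [Nat.cast_sub (by omega)]; push_cast; linarith
      rw [zero_add]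
      gcongr
    linarith
  have nn : ∀ m : ℕ, 0 ≤ 1 / ((m + (n + 1)).descFactorial (ν + 1) : ℝ) := fun m => by positivity
  exact ⟨summable_of_sum_range_le nn bound, Real.tsum_le_of_sum_range_le nn bound⟩

lemma alias_poly (n k : ℕ) : ∃ q : ℝ[X], q.degree < (n + 1 : ℕ) ∧ (∀ x : ℝ, |x| ≤ 1 → |q.eval x| ≤ 1) ∧
    (k ≤ n → ∀ t, q.eval (cos t) = cos (k * t)) ∧
    ∀ j : ℕ, q.eval (cos ((2 * j + 1) * π / (2 * n + 2))) = cos (k * ((2 * j + 1) * π / (2 * n + 2))) := by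
  induction k using Nat.strong_induction_on with
  | _ k ih =>
  rcases lt_trichotomy k (n + 1) with h | h | h
  · refine ⟨Chebyshev.T ℝ k, ?_, ?_, ?_, ?_⟩
    · rw [Chebyshev.degree_T, Int.natAbs_natCast]; exact_mod_cast h
    · intro x hx; exact Chebyshev.abs_eval_T_real_le_one _ hx
    · intro _ t; rw [Chebyshev.T_real_cos]; simp
    · intro j; rw [Chebyshev.T_real_cos]; simp
  · refine ⟨0, by simp, by simp, by omega, ?_⟩
    intro j
    rw [eval_zero, eq_comm, cos_eq_zero_iff]
    refine ⟨j, ?_⟩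
    rw [h]; push_cast; field_simp
  · -- reflect: use index |2(n+1) - k|
    obtain ⟨m, hm, hmk⟩ : ∃ m < k, k + m = 2 * (n + 1) ∨ k = 2 * (n + 1) + m := by
      rcases le_total k (2 * (n + 1)) with h2 | h2
      · exact ⟨2 * (n + 1) - k, by omega, by omega⟩
      · exact ⟨k - 2 * (n + 1), by omega, by omega⟩
    obtain ⟨q, q1, q2, -, q4⟩ := ih m hm
    refine ⟨-q, by rwa [degree_neg], fun x hx => by rw [eval_neg, abs_neg]; exact q2 x hx, by omega, ?_⟩
    intro j
    rw [eval_neg, q4 j]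
    set φ := (2 * (j:ℝ) + 1) * π / (2 * n + 2) with hφ
    have hφ2 : 2 * ((n:ℝ) + 1) * φ = π + j * (2 * π) := by rw [hφ]; field_simp; ring
    rcases hmk with e | e
    · have : (k:ℝ) * φ = (π + j * (2 * π)) - m * φ := by
        rw [← hφ2]
        have : (k:ℝ) + m = 2 * (n + 1) := by exact_mod_cast e
        rw [← this]; ring
      rw [this, show π + j * (2 * π) - m * φ = (π - m * φ) + j * (2 * π) by ring, cos_add_nat_mul_two_pi, cos_pi_sub]
    · have : (k:ℝ) * φ = (m * φ + π) + j * (2 * π) := by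
        have : (k:ℝ) = 2 * (n + 1) + m := by exact_mod_cast e
        rw [this, add_mul, hφ2]; ring
      rw [this, cos_add_nat_mul_two_pi, cos_add_pi]

/-- If `f` is `ν` times differentiable on `[-1,1]` and its `ν`-th derivative
has bounded total variation `V` there, then interpolation at the `n+1`
Chebyshev nodes (for `n > ν`) has uniform error at most
`4V / (π ν (n - ν)^ν)`. -/
theorem chebyshev_interpolation_bounded_variation_rate
    (ν : ℕ) (hν : 1 ≤ ν) (f : ℝ → ℝ)
    (hdiff : ∀ i < ν,
      DifferentiableOn ℝ (iteratedDerivWithin i f (Set.Icc (-1 : ℝ) 1))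
        (Set.Icc (-1 : ℝ) 1))
    (hbv : BoundedVariationOn (iteratedDerivWithin ν f (Set.Icc (-1 : ℝ) 1))
      (Set.Icc (-1 : ℝ) 1))
    (V : ℝ)
    (hV : V = (eVariationOn (iteratedDerivWithin ν f (Set.Icc (-1 : ℝ) 1))
      (Set.Icc (-1 : ℝ) 1)).toReal)
    (n : ℕ) (hn : ν < n)
    (nodes : Fin (n + 1) → ℝ)
    (hnodes : ∀ k : Fin (n + 1),
      nodes k = Real.cos ((2 * (k : ℕ) + 1) * π / (2 * n + 2)))
    (p : ℝ[X])
    (hp : p = Lagrange.interpolate Finset.univ nodes (fun k => f (nodes k))) :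
    sSup ((fun x => |f x - p.eval x|) '' Set.Icc (-1 : ℝ) 1) ≤
      4 * V / (π * ν * ((n : ℝ) - ν) ^ ν) := by
  classical
  set S := Icc (-1 : ℝ) 1 with hS
  set g : ℕ → ℝ → ℝ := fun i => iteratedDerivWithin i f S with hg
  have hg0 : g 0 = f := by simp only [hg]; exact iteratedDerivWithin_zero
  have hd : ∀ i < ν, ∀ x ∈ S, HasDerivWithinAt (g i) (g (i + 1) x) S x := by
    intro i hi x hx
    have := (hdiff i hi x hx).hasDerivWithinAt
    simp only [hg]
    rwa [iteratedDerivWithin_succ]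
  set c : ℕ → ℝ := fun k => ∫ t in (0:ℝ)..π, f (cos t) * cos (k * t) with hc
  have hcb : ∀ k, ν < k → |c k| ≤ V / (k.descFactorial (ν + 1)) := by
    intro k hk
    have := coeff_bound ν g hd hbv k hk
    rw [hg0] at this
    rw [hV]
    exact this
  have hV0 : 0 ≤ V := by rw [hV]; exact ENNReal.toReal_nonneg
  obtain ⟨ts, tb⟩ := desc_tail ν n hν hn
  have hcs : Summable c := by
    rw [← summable_nat_add_iff (n + 1)]
    refine Summable.of_norm_bounded (ts.mul_left V) fun m => ?_
    rw [Real.norm_eq_abs, mul_one_div]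
    exact hcb _ (by omega)
  have hfc : Continuous (fun t => f (cos t)) := by
    have : ContinuousOn f S := fun x hx => by
      have := (hd 0 hν x hx).continuousWithinAt
      rwa [hg0] at this
    exact this.comp_continuous continuous_cos cos_mem_Icc
  have hexp := fourier_expand hfc (fun t => by simp only [cos_add_two_pi])
    (fun t => by simp only [cos_neg]) c (fun k => rfl) hcs
  have hinj : Set.InjOn nodes (Finset.univ : Finset (Fin (n + 1))) := by
    intro i _ j _ hij
    rw [hnodes, hnodes] at hij
    have hm : ∀ i : Fin (n + 1), (2 * ((i : ℕ) : ℝ) + 1) * π / (2 * n + 2) ∈ Icc 0 π := by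
      intro i
      have hi : ((i : ℕ) : ℝ) ≤ n := by exact_mod_cast Nat.lt_succ_iff.1 i.2
      refine ⟨by positivity, ?_⟩
      rw [div_le_iff₀ (by positivity), mul_comm]
      gcongr
      linarith
    have := injOn_cos (hm i) (hm j) hij
    field_simp at this
    have h2 : ((i : ℕ) : ℝ) = (j : ℕ) := by linarith
    exact Fin.ext (by exact_mod_cast h2)
  set w : ℝ → Fin (n + 1) → ℝ := fun x j => (Lagrange.basis Finset.univ nodes j).eval x with hw
  have heval : ∀ (r : Fin (n + 1) → ℝ) x,
      (Lagrange.interpolate Finset.univ nodes r).eval x = ∑ j, r j * w x j := by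
    intro r x
    rw [Lagrange.interpolate_apply, eval_finsetSum]
    simp [hw]
  have hpoly : ∀ (q : ℝ[X]), q.degree < (n + 1 : ℕ) → ∀ x, ∑ j, q.eval (nodes j) * w x j = q.eval x := by
    intro q hq x
    rw [← heval]
    conv_rhs => rw [Lagrange.eq_interpolate hinj (f := q) (by simpa using hq)]
  refine csSup_le ((nonempty_Icc.2 (by norm_num)).image _) ?_
  rintro _ ⟨x, hx, rfl⟩
  simp only
  have hxa : |x| ≤ 1 := abs_le.2 hx
  obtain ⟨θ, rfl⟩ : ∃ θ, x = cos θ := ⟨arccos x, (cos_arccos hx.1 hx.2).symm⟩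
  set φ : Fin (n + 1) → ℝ := fun j => (2 * ((j : ℕ) : ℝ) + 1) * π / (2 * n + 2) with hφ
  have hnφ : ∀ j, nodes j = cos (φ j) := hnodes
  set L : ℕ → ℝ := fun k => cos (k * θ) - ∑ j, cos (k * φ j) * w (cos θ) j with hL
  have hL0 : ∀ k ≤ n, L k = 0 := by
    intro k hk
    obtain ⟨q, q1, q2, q3, q4⟩ := alias_poly n k
    have := hpoly q q1 (cos θ)
    simp only [hL]
    rw [← q3 hk θ, ← this, sub_eq_zero]
    refine Finset.sum_congr rfl fun j _ => ?_
    rw [hnφ, q4 j]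
  have hL2 : ∀ k, |L k| ≤ 2 := by
    intro k
    obtain ⟨q, q1, q2, q3, q4⟩ := alias_poly n k
    have h1 : L k = cos (k * θ) - q.eval (cos θ) := by
      simp only [hL]
      rw [← hpoly q q1 (cos θ)]
      congr 1
      refine Finset.sum_congr rfl fun j _ => ?_
      rw [hnφ, q4 j]
    rw [h1]
    refine (abs_sub _ _).trans ?_
    have := q2 (cos θ) hxa
    have := abs_cos_le_one (k * θ)
    linarith
  have hone : ∑ j, w (cos θ) j = 1 := by
    have := hpoly 1 (by rw [degree_one]; exact_mod_cast Nat.succ_pos n) (cos θ)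
    simpa using this
  have hsum : HasSum (fun k => 2 * c k / π * L k) (f (cos θ) - p.eval (cos θ)) := by
    have h1 := hasSum_sum (s := Finset.univ) fun (j : Fin (n + 1)) _ => (hexp (φ j)).mul_right (w (cos θ) j)
    have h2 := (hexp θ).sub h1
    have e1 : (fun k => 2 * c k / π * L k) = fun b : ℕ => 2 * c b / π * cos (b * θ) -
        ∑ i, 2 * c b / π * cos (b * φ i) * w (cos θ) i := by
      funext k
      simp only [hL]
      rw [mul_sub, Finset.mul_sum]
      congr 1
      refine Finset.sum_congr rfl fun j _ => ?_
      ring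
    have e2 : f (cos θ) - p.eval (cos θ) = f (cos θ) + c 0 / π -
        ∑ i, (f (cos (φ i)) + c 0 / π) * w (cos θ) i := by
      rw [hp, heval]
      simp only [add_mul, Finset.sum_add_distrib, ← Finset.mul_sum, hone, hnφ]
      ring
    rw [e1, e2]
    exact h2
  rw [← hasSum_nat_add_iff' (n + 1)] at hsum
  have hz : ∑ i ∈ Finset.range (n + 1), 2 * c i / π * L i = 0 := by
    refine Finset.sum_eq_zero fun i hi => ?_
    rw [hL0 i (Nat.lt_succ_iff.1 (Finset.mem_range.1 hi)), mul_zero]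
  rw [hz, sub_zero] at hsum
  have hB := (ts.mul_left (4 * V / π)).hasSum
  have hfin := tsum_of_norm_bounded hB (f := fun m => 2 * c (m + (n + 1)) / π * L (m + (n + 1))) (fun m => by
    have h1 := hcb (m + (n + 1)) (by omega)
    have h2 := hL2 (m + (n + 1))
    rw [Real.norm_eq_abs, abs_mul, abs_div, abs_mul, abs_two, abs_of_pos pi_pos]
    calc 2 * |c (m + (n + 1))| / π * |L (m + (n + 1))|
        ≤ 2 * (V / ((m + (n + 1)).descFactorial (ν + 1))) / π * 2 := by gcongr
      _ = _ := by ring)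
  rw [hsum.tsum_eq, Real.norm_eq_abs, tsum_mul_left] at hfin
  refine hfin.trans ?_
  calc _ ≤ 4 * V / π * (1 / (ν * ((n:ℝ) - ν) ^ ν)) := by gcongr
    _ = _ := by rw [div_mul_div_comm, mul_one, mul_assoc]
end

section
/- The Runge function f(x) = 1/(1 + 6.25 x²) on the interval [-2,2] is not approximated by interpolation on equidistant nodes: if for each n ≥ 1, p_n denotes the unique polynomial of degree at most n interpolating f at the n+1 equidistant nodes x_k = -2 + 4k/n, k = 0, …, n, then the uniform errors sup_{x ∈ [-2,2]} |f(x) - p_n(x)| do not converge to 0 as n → ∞; in fact they are unbounded. -/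
open Real Set Polynomial Filter

lemma runge_poly_ineq (l : ℝ) (hl : 0 ≤ l) :
    (3 / 2) * ((2*(6*l+3+1)) * (2*(6*l+4+1)) * (2*(6*l+5+1)) * (2*(6*l+6+1)) * (2*(6*l+7+1)) * (2*(6*l+8+1)))^2
      ≤ ((2*(10*l+5)+1) * (2*(10*l+6)+1) * (2*(10*l+7)+1) * (2*(10*l+8)+1) * (2*(10*l+9)+1)
        * (2*(10*l+10)+1) * (2*(10*l+11)+1) * (2*(10*l+12)+1) * (2*(10*l+13)+1) * (2*(10*l+14)+1))
        * (2*(l+1))^2 := by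
  rw [← sub_nonneg]
  ring_nf
  positivity

lemma runge_growth (l : ℕ) :
    (3 / 2 : ℝ) ^ l * (1 / 4) * (∏ j ∈ Finset.range (6 * l + 3), (2 * ((j : ℝ) + 1))) ^ 2
      ≤ (∏ j ∈ Finset.range (10 * l + 5), (2 * (j : ℝ) + 1))
        * (∏ j ∈ Finset.range l, (2 * ((j : ℝ) + 1))) ^ 2 := by
  induction l with
  | zero => norm_num [Finset.prod_range_succ]
  | succ l ih =>
    have h := runge_poly_ineq l (Nat.cast_nonneg l)
    have e1 : 6 * (l + 1) + 3 = 6 * l + 3 + 1 + 1 + 1 + 1 + 1 + 1 := by ring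
    have e2 : 10 * (l + 1) + 5 = 10 * l + 5 + 1 + 1 + 1 + 1 + 1 + 1 + 1 + 1 + 1 + 1 := by ring
    rw [e1, e2]
    obtain ⟨a, ha⟩ : ∃ a, a = 6 * l + 3 := ⟨_, rfl⟩
    obtain ⟨b, hb⟩ : ∃ b, b = 10 * l + 5 := ⟨_, rfl⟩
    have har : (a : ℝ) = 6 * l + 3 := by rw [ha]; push_cast; ring
    have hbr : (b : ℝ) = 10 * l + 5 := by rw [hb]; push_cast; ring
    rw [← ha, ← hb] at ih ⊢
    simp only [Finset.prod_range_succ]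
    have hB : 0 ≤ (3 / 2 : ℝ) ^ l * (1 / 4) *
      (∏ j ∈ Finset.range a, (2 * ((j : ℝ) + 1))) ^ 2 := by positivity
    have hm := mul_le_mul ih h (by positivity) (hB.trans ih)
    generalize (∏ j ∈ Finset.range a, (2 * ((j : ℝ) + 1))) = B at *
    generalize (∏ j ∈ Finset.range b, (2 * (j : ℝ) + 1)) = A at *
    generalize (∏ j ∈ Finset.range l, (2 * ((j : ℝ) + 1))) = K at *
    push_cast
    rw [har, hbr]
    rw [pow_succ]
    refine le_trans (le_of_eq ?_) (hm.trans (le_of_eq ?_))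
    · ring
    · ring

/-- numerator -/
lemma runge_num (m : ℕ) :
    ∏ j ∈ Finset.range (m + 1), |(2 * (m : ℝ)) ^ 2 - (2 * (j : ℝ) + 1) ^ 2|
      = ∏ j ∈ Finset.range (2 * m + 1), (2 * (j : ℝ) + 1) := by
  have h1 : ∀ j : ℕ, |(2 * (m : ℝ)) ^ 2 - (2 * (j : ℝ) + 1) ^ 2|
      = |2 * (m : ℝ) - (2 * j + 1)| * (2 * ((m + j : ℕ) : ℝ) + 1) := by
    intro j
    rw [show (2 * (m : ℝ)) ^ 2 - (2 * (j : ℝ) + 1) ^ 2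
      = (2 * (m : ℝ) - (2 * j + 1)) * (2 * ((m + j : ℕ) : ℝ) + 1) by push_cast; ring, abs_mul]
    congr 1
    exact abs_of_nonneg (by positivity)
  simp only [h1]
  rw [Finset.prod_mul_distrib, show 2 * m + 1 = m + (m + 1) by ring,
    Finset.prod_range_add _ m (m + 1)]
  congr 1
  rw [Finset.prod_range_succ, ← Finset.prod_range_reflect]
  have : |2 * (m : ℝ) - (2 * m + 1)| = 1 := by
    rw [show 2 * (m : ℝ) - (2 * m + 1) = -1 by ring]; norm_num
  rw [this, mul_one]
  refine Finset.prod_congr rfl fun j hj => ?_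
  have hj := Finset.mem_range.1 hj
  have : ((m - 1 - j : ℕ) : ℝ) = m - 1 - j := by
    rw [Nat.sub_sub, Nat.cast_sub (by omega)]; push_cast; ring
  rw [this, show 2 * (m : ℝ) - (2 * (m - 1 - j) + 1) = 2 * j + 1 by ring]
  exact abs_of_nonneg (by positivity)

lemma runge_den (l : ℕ) :
    (∏ j ∈ Finset.range (5 * l + 2 + 1), ((2 * (l : ℝ) + 1) ^ 2 + (2 * (j : ℝ) + 1) ^ 2))
      * (∏ j ∈ Finset.range l, (2 * ((j : ℝ) + 1))) ^ 2
      ≤ (∏ j ∈ Finset.range (6 * l + 3), (2 * ((j : ℝ) + 1))) ^ 2 := by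
  rw [show 6 * l + 3 = l + (5 * l + 2 + 1) by ring, Finset.prod_range_add _ l, mul_pow,
    mul_comm]
  refine mul_le_mul_of_nonneg_left ?_ (by positivity)
  rw [← Finset.prod_pow]
  refine Finset.prod_le_prod (fun _ _ => by positivity) fun j _ => ?_
  push_cast
  have : (0:ℝ) ≤ l := by positivity
  have : (0:ℝ) ≤ j := by positivity
  nlinarith [mul_nonneg ‹(0:ℝ) ≤ l› ‹(0:ℝ) ≤ j›]

lemma runge_ratio (l : ℕ) :
    (3 / 2 : ℝ) ^ l * (1 / 4) *
      (∏ j ∈ Finset.range (5 * l + 2 + 1), ((2 * (l : ℝ) + 1) ^ 2 + (2 * (j : ℝ) + 1) ^ 2))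
      ≤ ∏ j ∈ Finset.range (5 * l + 2 + 1),
        |(2 * ((5 * l + 2 : ℕ) : ℝ)) ^ 2 - (2 * (j : ℝ) + 1) ^ 2| := by
  rw [runge_num, show 2 * (5 * l + 2) + 1 = 10 * l + 5 by ring]
  have hK : 0 < (∏ j ∈ Finset.range l, (2 * ((j : ℝ) + 1))) ^ 2 := by
    have : 0 < ∏ j ∈ Finset.range l, (2 * ((j : ℝ) + 1)) :=
      Finset.prod_pos fun _ _ => by positivity
    positivity
  refine le_of_mul_le_mul_right ?_ hK
  refine le_trans ?_ (runge_growth l)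
  rw [mul_assoc]
  exact mul_le_mul_of_nonneg_left (runge_den l) (by positivity)

/-- The error formula for odd `n`. -/
lemma runge_error (f : ℝ → ℝ) (hf : ∀ x : ℝ, f x = 1 / (1 + 6.25 * x ^ 2)) (m n : ℕ)
    (hn : n = 2 * m + 1) (V : ℝ[X])
    (hV : V = ∏ j ∈ Finset.range (m + 1), (X - C ((2 * (2 * (j : ℝ) + 1) / n) ^ 2)))
    (x : ℝ) :
    f x - (Lagrange.interpolate Finset.univ
      (fun k : Fin (n + 1) => -2 + 4 * (k : ℝ) / n)
      (fun k : Fin (n + 1) => f (-2 + 4 * (k : ℝ) / n))).eval x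
      = f x * (V.eval (x ^ 2) / V.eval (-0.16)) := by
  have hn0 : (0 : ℝ) < n := by rw [hn]; positivity
  have hV0 : V.eval (-0.16) ≠ 0 := by
    rw [hV, eval_prod, Finset.prod_ne_zero_iff]
    intro j _
    simp only [eval_sub, eval_X, eval_C]
    have := sq_nonneg (2 * (2 * (j : ℝ) + 1) / n)
    apply ne_of_lt
    norm_num
    linarith
  have hVdeg : V.natDegree = m + 1 := by
    rw [hV, natDegree_prod_of_monic _ _ (fun j _ => monic_X_sub_C _)]
    simp only [natDegree_X_sub_C]
    simp
  set U : ℝ[X] := 1 - C (V.eval (-0.16))⁻¹ * V with hU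
  have hUdeg : U.natDegree ≤ m + 1 := by
    refine (natDegree_sub_le _ _).trans ?_
    simp only [natDegree_one, zero_le, sup_of_le_right]
    exact (natDegree_C_mul_le _ _).trans hVdeg.le
  have hroot : U.IsRoot (-0.16) := by
    simp only [IsRoot, hU, eval_sub, eval_one, eval_mul, eval_C]
    rw [inv_mul_cancel₀ hV0, sub_self]
  have hdiv := mul_divByMonic_eq_iff_isRoot.2 hroot
  set q := U /ₘ (X - C (-0.16)) with hq
  have hqdeg : q.natDegree ≤ m := by
    rw [hq, natDegree_divByMonic _ (monic_X_sub_C _), natDegree_X_sub_C]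
    omega
  have hqe : ∀ t : ℝ, (t + 0.16) * q.eval t = 1 - V.eval t / V.eval (-0.16) := by
    intro t
    have := congrArg (eval t) hdiv
    simp only [hU, eval_sub, eval_one, eval_mul, eval_C, eval_X] at this
    rw [sub_neg_eq_add] at this
    rw [this]; ring
  set r : ℝ[X] := C (0.16) * q.comp (X ^ 2) with hr
  have hre : ∀ y : ℝ, r.eval y = f y * (1 - V.eval (y ^ 2) / V.eval (-0.16)) := by
    intro y
    rw [← hqe, hf, hr]
    simp only [eval_mul, eval_C, eval_comp, eval_pow, eval_X]
    have : (1 + 6.25 * y ^ 2 : ℝ) ≠ 0 := by positivity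
    field_simp
    norm_num
    ring
  have hrdeg : r.degree < (Finset.univ : Finset (Fin (n + 1))).card := by
    rw [Finset.card_univ, Fintype.card_fin]
    refine degree_le_natDegree.trans_lt ?_
    have : r.natDegree ≤ m * 2 := by
      refine (natDegree_C_mul_le _ _).trans ?_
      rw [natDegree_comp, natDegree_X_pow]
      exact Nat.mul_le_mul_right _ hqdeg
    exact_mod_cast (show r.natDegree < n + 1 by omega)
  have hinj : Set.InjOn (fun k : Fin (n + 1) => -2 + 4 * (k : ℝ) / n)
      (Finset.univ : Finset (Fin (n + 1))) := by
    intro a _ b _ hab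
    have h1 : 4 * (a : ℝ) / n = 4 * (b : ℝ) / n := by simpa using hab
    rw [div_left_inj' hn0.ne'] at h1
    have h2 : (a : ℝ) = b := by linarith
    exact Fin.ext (by exact_mod_cast h2)
  have key : r = Lagrange.interpolate Finset.univ
      (fun k : Fin (n + 1) => -2 + 4 * (k : ℝ) / n)
      (fun k : Fin (n + 1) => f (-2 + 4 * (k : ℝ) / n)) := by
    refine Lagrange.eq_interpolate_of_eval_eq _ hinj hrdeg ?_
    intro k _
    rw [hre]
    have hz : V.eval ((-2 + 4 * (k : ℝ) / n) ^ 2) = 0 := by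
      rw [hV, eval_prod, Finset.prod_eq_zero_iff]
      have hk := k.2
      have hnr : (n : ℝ) = 2 * m + 1 := by rw [hn]; push_cast; ring
      by_cases hkm : (k : ℕ) ≤ m
      · refine ⟨m - k, Finset.mem_range.2 (by omega), ?_⟩
        simp only [eval_sub, eval_X, eval_C]
        rw [Nat.cast_sub hkm]
        field_simp
        rw [hnr]; ring
      · refine ⟨k - (m + 1), Finset.mem_range.2 (by omega), ?_⟩
        simp only [eval_sub, eval_X, eval_C]
        rw [Nat.cast_sub (by omega)]
        push_cast
        field_simp
        rw [hnr]; ring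
    rw [hz]; simp
  rw [← key, hre]
  ring

theorem runge_equidistant_interpolation_diverges
    (f : ℝ → ℝ) (hf : ∀ x : ℝ, f x = 1 / (1 + 6.25 * x ^ 2))
    (p : ℕ → ℝ[X])
    (hp : ∀ n : ℕ, 1 ≤ n → p n = Lagrange.interpolate Finset.univ
      (fun k : Fin (n + 1) => -2 + 4 * (k : ℝ) / n)
      (fun k : Fin (n + 1) => f (-2 + 4 * (k : ℝ) / n)))
    (err : ℕ → ℝ)
    (herr : ∀ n : ℕ, err n =
      sSup ((fun x => |f x - (p n).eval x|) '' Set.Icc (-2 : ℝ) 2)) :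
    ¬ Tendsto err atTop (nhds 0) ∧ ¬ BddAbove (err '' {n : ℕ | 1 ≤ n}) := by
  have hfc : Continuous f := by
    rw [show f = fun x => 1 / (1 + 6.25 * x ^ 2) from funext hf]
    refine Continuous.div (by fun_prop) (by fun_prop) fun x => by positivity
  have main : ∀ l : ℕ, (3 / 2 : ℝ) ^ l * (1 / 4) * (1 / 26) ≤ err (2 * (5 * l + 2) + 1) := by
    intro l
    obtain ⟨m, hm⟩ : ∃ m, m = 5 * l + 2 := ⟨_, rfl⟩
    obtain ⟨n, hn⟩ : ∃ n, n = 2 * m + 1 := ⟨_, rfl⟩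
    rw [← hm, ← hn]
    have hmr : (m : ℝ) = 5 * l + 2 := by rw [hm]; push_cast; ring
    have hnr : (n : ℝ) = 2 * m + 1 := by rw [hn]; push_cast; ring
    have hn0 : (0 : ℝ) < n := by rw [hn]; positivity
    have hx0 : (0 : ℝ) ≤ 4 * m / n := by positivity
    have hx2 : 4 * (m : ℝ) / n ≤ 2 := by
      rw [div_le_iff₀ hn0, hnr]; linarith
    have hbdd : BddAbove ((fun x => |f x - (p n).eval x|) '' Set.Icc (-2 : ℝ) 2) :=
      (isCompact_Icc.image (hfc.sub (p n).continuous).abs).bddAbove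
    rw [herr]
    refine le_trans ?_ (le_csSup hbdd ⟨4 * m / n, ⟨by linarith, hx2⟩, rfl⟩)
    simp only
    rw [hp n (by omega), runge_error f hf m n hn _ rfl, abs_mul, mul_comm]
    refine mul_le_mul ?_ ?_ (by positivity) (abs_nonneg _)
    · rw [hf, abs_of_nonneg (by positivity)]
      refine one_div_le_one_div_of_le (by positivity) ?_
      nlinarith
    · rw [eval_prod, eval_prod, abs_div, Finset.abs_prod, Finset.abs_prod]
      have e1 : ∀ j : ℕ, |eval ((4 * (m : ℝ) / n) ^ 2) (X - C ((2 * (2 * (j : ℝ) + 1) / n) ^ 2))|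
          = (4 / (n : ℝ) ^ 2) * |(2 * (m : ℝ)) ^ 2 - (2 * (j : ℝ) + 1) ^ 2| := by
        intro j
        rw [← abs_of_nonneg (show (0:ℝ) ≤ 4 / (n : ℝ) ^ 2 by positivity), ← abs_mul]
        congr 1
        simp only [eval_sub, eval_X, eval_C]
        field_simp
        ring
      have e2 : ∀ j : ℕ, |eval (-0.16) (X - C ((2 * (2 * (j : ℝ) + 1) / n) ^ 2))|
          = (4 / (n : ℝ) ^ 2) * ((2 * (l : ℝ) + 1) ^ 2 + (2 * (j : ℝ) + 1) ^ 2) := by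
        intro j
        have hl : 2 * (l : ℝ) + 1 = n / 5 := by rw [hnr, hmr]; ring
        have : eval (-0.16) (X - C ((2 * (2 * (j : ℝ) + 1) / n) ^ 2))
            = -((4 / (n : ℝ) ^ 2) * ((2 * (l : ℝ) + 1) ^ 2 + (2 * (j : ℝ) + 1) ^ 2)) := by
          rw [hl]
          simp only [eval_sub, eval_X, eval_C]
          field_simp
          ring
        rw [this, abs_neg, abs_of_nonneg (by positivity)]
      simp only [e1, e2]
      rw [Finset.prod_mul_distrib, Finset.prod_mul_distrib,
        mul_div_mul_left _ _ (Finset.prod_ne_zero_iff.2 fun _ _ => by positivity),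
        le_div_iff₀ (Finset.prod_pos fun _ _ => by positivity)]
      have := runge_ratio l
      rwa [← hm] at this
  have hunb : ¬ BddAbove (err '' {n : ℕ | 1 ≤ n}) := by
    rintro ⟨M, hM⟩
    obtain ⟨l, hl⟩ := pow_unbounded_of_one_lt (M * 104) (show (1:ℝ) < 3 / 2 by norm_num)
    have h1 := main l
    have h2 := hM ⟨2 * (5 * l + 2) + 1, by simp, rfl⟩
    linarith
  refine ⟨fun h => hunb ?_, hunb⟩
  exact h.bddAbove_range.mono (Set.image_subset_range _ _)
end
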